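/- Let M be a metric space of doubling dimension at most D, let S be a finite set of points of M, let k, z be positive integers with k + z < |S|, and let 0 < ε ≤ 1. Let r̂ satisfy r_{k+z}^*(S) ≤ r̂ ≤ 8 · r_{k+z}^*(S), and let T ⊆ S be a maximal subset of S whose points are pairwise at distance greater than (ε/48) · r̂ from one another. Then: (i) every s ∈ S satisfies d(s, T) ≤ (ε/6) · r_{k+z}^*(S), and (ii) |T| ≤ (k + z) · 2^{D·⌈log₂(96/ε)⌉}. -/

import Mathlib

/-- Distance-based radius of a finite set `S` with respect to a finite set
of centers `T`: `r_T(S) = max_{s ∈ S} d(s, T)`. -/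
noncomputable def radius {α : Type*} [MetricSpace α] (S T : Finset α) : ℝ :=
  sSup ((fun s => Metric.infDist s (T : Set α)) '' (S : Set α))

/-- Optimal radius of the `k`-center problem on `S`. -/
noncomputable def optRadius {α : Type*} [MetricSpace α] (S : Finset α) (k : ℕ) : ℝ :=
  sInf ((fun T => radius S T) '' {T : Finset α | T ⊆ S ∧ T.card = k})

/-- Optimal radius of the `k`-center problem with `z` outliers on `S`. -/
noncomputable def optRadiusOut {α : Type*} [MetricSpace α] [DecidableEq α]
    (S : Finset α) (k z : ℕ) : ℝ :=
  sInf {r : ℝ | ∃ T Z : Finset α, T ⊆ S ∧ T.card = k ∧ Z ⊆ S ∧ Z.card = z ∧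
    radius (S \ Z) T = r}

/-- `t : ℕ → α` is a greedy (GMM) sequence in the finite set `X`: `t 0 ∈ X` and
each `t (j+1)` is a point of `X` at maximum distance from `{t 0, …, t j}`. -/
def IsGMM {α : Type*} [MetricSpace α] [DecidableEq α] (X : Finset α) (t : ℕ → α) : Prop :=
  t 0 ∈ X ∧ ∀ j : ℕ, t (j + 1) ∈ X ∧ ∀ x ∈ X,
    Metric.infDist x (((Finset.range (j + 1)).image t : Finset α) : Set α) ≤
      Metric.infDist (t (j + 1)) (((Finset.range (j + 1)).image t : Finset α) : Set α)

/-- A metric space has doubling dimension at most `D` if every closed ball of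
radius `r` is covered by at most `2^D` closed balls of radius `r/2`. -/
def DoublingDimLE (α : Type*) [MetricSpace α] (D : ℕ) : Prop :=
  ∀ (x : α) (r : ℝ), 0 < r → ∃ Y : Finset α, Y.card ≤ 2 ^ D ∧
    Metric.closedBall x r ⊆ ⋃ y ∈ Y, Metric.closedBall y (r / 2)

theorem infDist_le_radius {α : Type*} [MetricSpace α] {S T : Finset α} {s : α} (hs : s ∈ S) :
    Metric.infDist s (T : Set α) ≤ radius S T :=
  le_csSup (S.finite_toSet.image _).bddAbove (Set.mem_image_of_mem _ hs)

/-- The optimal radius is attained by some set of centers. -/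
theorem exists_radius_eq_optRadius {α : Type*} [MetricSpace α] {S : Finset α} {n : ℕ}
    (hn : n ≤ S.card) : ∃ C ⊆ S, C.card = n ∧ radius S C = optRadius S n := by
  have hfin : {C : Finset α | C ⊆ S ∧ C.card = n}.Finite :=
    S.powerset.finite_toSet.subset fun C hC => Finset.mem_coe.2 (Finset.mem_powerset.2 hC.1)
  obtain ⟨C, hCS, hC⟩ := Finset.exists_subset_card_eq hn
  have hne : {C : Finset α | C ⊆ S ∧ C.card = n}.Nonempty := ⟨C, hCS, hC⟩
  obtain ⟨C, ⟨hCS, hC⟩, h⟩ :=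
    (hne.image fun C => radius S C).csInf_mem (hfin.image fun C => radius S C)
  exact ⟨C, hCS, hC, h⟩

theorem exists_dist_le_radius {α : Type*} [MetricSpace α] {S C : Finset α} (hC : C.Nonempty)
    {s : α} (hs : s ∈ S) : ∃ c ∈ C, dist s c ≤ radius S C := by
  obtain ⟨c, hc, h⟩ := C.finite_toSet.isCompact.exists_infDist_eq_dist hC s
  exact ⟨c, hc, h ▸ infDist_le_radius hs⟩

theorem radius_pos_of_card_lt {α : Type*} [MetricSpace α] {S C : Finset α} (hC : C.Nonempty)
    (h : C.card < S.card) : 0 < radius S C := by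
  obtain ⟨s, hs, hsC⟩ := Finset.exists_mem_notMem_of_card_lt_card h
  obtain ⟨c, hc, hd⟩ := exists_dist_le_radius hC hs
  exact (dist_pos.2 (ne_of_mem_of_not_mem hc hsC).symm).trans_le hd

/-- Halving the radius `j` times in a doubling space. -/
theorem DoublingDimLE.exists_cover {α : Type*} [MetricSpace α] {D : ℕ} (hD : DoublingDimLE α D)
    {r : ℝ} (hr : 0 < r) (C : Finset α) (j : ℕ) :
    ∃ Y : Finset α, Y.card ≤ C.card * 2 ^ (D * j) ∧
      ∀ s, (∃ c ∈ C, dist s c ≤ r) → ∃ y ∈ Y, dist s y ≤ r / 2 ^ j := by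
  classical
  induction j with
  | zero => exact ⟨C, by simp, fun s hs => by simpa using hs⟩
  | succ j ih =>
    obtain ⟨Y, hY, hcov⟩ := ih
    choose B hB hBcov using fun y => hD y (r / 2 ^ j) (by positivity)
    refine ⟨Y.biUnion B, ?_, fun s hs => ?_⟩
    · calc (Y.biUnion B).card ≤ Y.card * 2 ^ D :=
          Finset.card_biUnion_le_card_mul _ _ _ fun y _ => hB y
        _ ≤ C.card * 2 ^ (D * j) * 2 ^ D := Nat.mul_le_mul_right _ hY
        _ = C.card * 2 ^ (D * (j + 1)) := by ring
    · obtain ⟨y, hy, hsy⟩ := hcov s hs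
      obtain ⟨x, hx, hsx⟩ := Set.mem_iUnion₂.1 (hBcov y (Metric.mem_closedBall.2 hsy))
      refine ⟨x, Finset.mem_biUnion.2 ⟨y, hy, hx⟩, ?_⟩
      rw [pow_succ, ← div_div]
      exact hsx

/-- A set with pairwise distances greater than `2 * δ` has at most as many points as any family of
closed balls of radius `δ` covering it. -/
theorem card_le_card_of_separated {α : Type*} [MetricSpace α] {T Y : Finset α} {δ : ℝ}
    (hsep : ∀ a ∈ T, ∀ b ∈ T, a ≠ b → 2 * δ < dist a b)
    (hcov : ∀ t ∈ T, ∃ y ∈ Y, dist t y ≤ δ) : T.card ≤ Y.card := by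
  choose! f hfY hf using hcov
  refine Finset.card_le_card_of_injOn f hfY fun a ha b hb hab => ?_
  by_contra hne
  have hb' := hf b hb
  rw [← hab] at hb'
  linarith [hsep a ha b hb hne, dist_triangle_right a b (f a), hf a ha]

/-- two-pass Streaming coreset: a maximal subset `T ⊆ S` of
points pairwise farther than `(ε/48)·r̂` apart, where
`r_{k+z}^*(S) ≤ r̂ ≤ 8·r_{k+z}^*(S)`, satisfies
(i) `d(s,T) ≤ (ε/6)·r_{k+z}^*(S)` for all `s ∈ S`, and
(ii) `|T| ≤ (k+z)·2^(D·⌈log₂(96/ε)⌉)`. -/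
theorem two_pass_coreset {α : Type*} [MetricSpace α] [DecidableEq α]
    (D : ℕ) (hD : DoublingDimLE α D)
    (S : Finset α) (k z : ℕ) (hk : 0 < k) (hz : 0 < z) (hkz : k + z < S.card)
    (ε : ℝ) (hε : 0 < ε) (hε1 : ε ≤ 1)
    (rhat : ℝ) (hr1 : optRadius S (k + z) ≤ rhat)
    (hr2 : rhat ≤ 8 * optRadius S (k + z))
    (T : Finset α) (hTS : T ⊆ S)
    (hsep : ∀ a ∈ T, ∀ b ∈ T, a ≠ b → ε / 48 * rhat < dist a b)
    (hmaximal : ∀ s ∈ S, s ∉ T → ∃ t ∈ T, dist s t ≤ ε / 48 * rhat) :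
    (∀ s ∈ S, Metric.infDist s (T : Set α) ≤ ε / 6 * optRadius S (k + z)) ∧
    T.card ≤ (k + z) * 2 ^ (D * ⌈Real.logb 2 (96 / ε)⌉₊) := by
  obtain ⟨C, -, hC, hrC⟩ := exists_radius_eq_optRadius hkz.le
  have hCne : C.Nonempty := Finset.card_pos.1 (by omega)
  have hr : 0 < optRadius S (k + z) := hrC ▸ radius_pos_of_card_lt hCne (hC ▸ hkz)
  refine ⟨fun s hs => ?_, ?_⟩
  · by_cases hsT : s ∈ T
    · rw [Metric.infDist_zero_of_mem (Finset.mem_coe.2 hsT)]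
      positivity
    · obtain ⟨t, ht, hst⟩ := hmaximal s hs hsT
      calc Metric.infDist s (T : Set α) ≤ dist s t :=
            Metric.infDist_le_dist_of_mem (Finset.mem_coe.2 ht)
        _ ≤ ε / 48 * rhat := hst
        _ ≤ ε / 48 * (8 * optRadius S (k + z)) := by gcongr
        _ = ε / 6 * optRadius S (k + z) := by ring
  · set j := ⌈Real.logb 2 (96 / ε)⌉₊
    have hj : 96 / ε ≤ 2 ^ j := by
      rw [← Real.rpow_natCast, ← Real.logb_le_iff_le_rpow one_lt_two (by positivity)]
      exact Nat.le_ceil _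
    obtain ⟨Y, hY, hcov⟩ := hD.exists_cover hr C j
    rw [hC] at hY
    refine (card_le_card_of_separated (fun a ha b hb hab => ?_) fun t ht =>
      hcov t (hrC ▸ exists_dist_le_radius hCne (hTS ht))).trans hY
    refine lt_of_le_of_lt ?_ (hsep a ha b hb hab)
    calc 2 * (optRadius S (k + z) / 2 ^ j) ≤ 2 * (optRadius S (k + z) / (96 / ε)) := by gcongr
      _ = ε / 48 * optRadius S (k + z) := by field_simp; norm_num
      _ ≤ ε / 48 * rhat := by gcongr
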